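/- Inductive step for the Grassmann scheme: let q be a prime power and let n, k satisfy n − k > 2 and k > 2. If every Boolean degree 1 function on J_q(n−1, k−1) is trivial, then every Boolean degree 1 function on J_q(n, k) is trivial. -/

import Mathlib

open Module

attribute [local instance] Classical.propDecidable

/-- The Grassmann scheme `J_q(n,k)`: the `k`-dimensional subspaces of `F^n`,
where `F` is a finite field of order `q`. -/
def Gr (F : Type*) [Field F] (n k : ℕ) :=
  {S : Submodule F (Fin n → F) // finrank F S = k}

/-- A Boolean function `f` on `J_q(n,k)` has degree 1 if
`f(S) = c + ∑_p c_p · 1_{p ⊆ S}`, summing over all points (1-dimensional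
subspaces) `p` of `F^n`. -/
def GrDegOne {F : Type*} [Field F] [Fintype F] {n k : ℕ} (f : Gr F n k → Bool) : Prop :=
  ∃ (c : ℝ) (C : Submodule F (Fin n → F) → ℝ), ∀ S : Gr F n k,
    (if f S then (1 : ℝ) else 0) =
      c + ∑ᶠ p ∈ {p : Submodule F (Fin n → F) | finrank F p = 1},
            C p * (if p ≤ S.val then (1 : ℝ) else 0)

/-- `f` is of one of the forms: constant 1, `p⁺`, `π⁺`, or `p⁺ ∨ π⁺` with
`p ⊄ π`, for a point `p` and a hyperplane `π`. -/
def GrTrivPat {F : Type*} [Field F] {n k : ℕ} (f : Gr F n k → Bool) : Prop :=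
  (∀ S, f S = true) ∨
  (∃ p : Submodule F (Fin n → F), finrank F p = 1 ∧
    ∀ S : Gr F n k, (f S = true ↔ p ≤ S.val)) ∨
  (∃ pi : Submodule F (Fin n → F), finrank F pi = n - 1 ∧
    ∀ S : Gr F n k, (f S = true ↔ S.val ≤ pi)) ∨
  (∃ p pi : Submodule F (Fin n → F), finrank F p = 1 ∧ finrank F pi = n - 1 ∧
    ¬ p ≤ pi ∧ ∀ S : Gr F n k, (f S = true ↔ (p ≤ S.val ∨ S.val ≤ pi)))

/-- A Boolean function on `J_q(n,k)` is trivial if it or its complement is the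
constant 1, `p⁺` for a point `p`, `π⁺` for a hyperplane `π`, or `p⁺ ∨ π⁺` with
`p ⊄ π`. -/
def GrTrivial {F : Type*} [Field F] {n k : ℕ} (f : Gr F n k → Bool) : Prop :=
  GrTrivPat f ∨ GrTrivPat (fun S => !(f S))

set_option linter.unusedSectionVars false
section GSaux
open Submodule

variable {F V : Type*} [Field F] [AddCommGroup V] [Module F V] [FiniteDimensional F V]

theorem gs_p1 {a b c d : Prop} (h : ¬ (a ↔ b)) (h' : (a ↔ c) ↔ (b ↔ d)) : c ↔ ¬ d := by
  tauto

theorem gs_p2 {a b c d : Prop} (h : a ↔ b) (h' : (a ↔ c) ↔ (b ↔ d)) : c ↔ d := by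
  tauto

theorem gs_cover2 (U A B : Submodule F V) (hA : ¬ U ≤ A) (hB : ¬ U ≤ B) :
    ∃ u ∈ U, u ∉ A ∧ u ∉ B := by
  obtain ⟨a, ha, ha'⟩ := SetLike.not_le_iff_exists.1 hA
  obtain ⟨b, hb, hb'⟩ := SetLike.not_le_iff_exists.1 hB
  by_cases h1 : a ∈ B
  · by_cases h2 : b ∈ A
    · refine ⟨a + b, U.add_mem ha hb, ?_, ?_⟩
      · intro h
        exact ha' (by simpa using A.sub_mem h h2)
      · intro h
        exact hb' (by simpa using B.sub_mem h h1)
    · exact ⟨b, hb, h2, hb'⟩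
  · exact ⟨a, ha, ha', h1⟩

theorem gs_exch {S : Submodule F V} {m v : V} (hm : m ∉ S) (h : m ∈ S ⊔ span F {v}) :
    v ∈ S ⊔ span F {m} := by
  obtain ⟨s, hs, w, hw, rfl⟩ := mem_sup.1 h
  obtain ⟨c, rfl⟩ := mem_span_singleton.1 hw
  have hc : c ≠ 0 := by
    rintro rfl
    simp at hm
    exact hm hs
  refine mem_sup.2 ⟨-(c⁻¹ • s), S.neg_mem (S.smul_mem _ hs), c⁻¹ • (s + c • v),
    mem_span_singleton.2 ⟨_, rfl⟩, ?_⟩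
  rw [smul_add, smul_smul, inv_mul_cancel₀ hc]
  simp

theorem gs_fin (S : Submodule F V) {v : V} (hv : v ∉ S) :
    finrank F ↥(S ⊔ span F {v}) = finrank F S + 1 := by
  have h0 : v ≠ 0 := by rintro rfl; exact hv S.zero_mem
  have h1 := finrank_sup_add_finrank_inf_eq S (span F {v})
  have h2 : S ⊓ span F {v} = ⊥ := by
    rw [eq_bot_iff]
    rintro x ⟨hx, hx'⟩
    obtain ⟨c, rfl⟩ := mem_span_singleton.1 hx'
    by_cases hc : c = 0
    · simp [hc]
    · exact absurd ((S.smul_mem_iff hc).1 hx) hv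
  rw [h2, finrank_bot, finrank_span_singleton h0] at h1
  simpa using h1

theorem gs_fin_le (S : Submodule F V) (v : V) :
    finrank F ↥(S ⊔ span F {v}) ≤ finrank F S + 1 := by
  by_cases hv : v ∈ S
  · rw [sup_eq_left.2 ((span_singleton_le_iff_mem _ _).2 hv)]; omega
  · rw [gs_fin S hv]

theorem gs_not_le {A B : Submodule F V} (h : finrank F B < finrank F A) : ¬ A ≤ B :=
  fun h' => absurd (finrank_mono h') (by omega)

theorem gs_ext {k : ℕ} (B : Submodule F V) (hB : k < finrank F B) (m₁ m₂ : V) :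
    ∀ (d : ℕ) (A : Submodule F V), A ≤ B → m₁ ∉ A → m₂ ∉ A → finrank F A + d = k →
    ∃ S : Submodule F V, A ≤ S ∧ S ≤ B ∧ finrank F S = k ∧ m₁ ∉ S ∧ m₂ ∉ S := by
  intro d
  induction d with
  | zero => intro A h h1 h2 h3; exact ⟨A, le_rfl, h, h3, h1, h2⟩
  | succ d ih =>
    intro A h h1 h2 h3
    have e1 := gs_fin_le A m₁
    have e2 := gs_fin_le A m₂
    obtain ⟨v, hv, hv1, hv2⟩ := gs_cover2 B (A ⊔ span F {m₁}) (A ⊔ span F {m₂})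
      (gs_not_le (by omega)) (gs_not_le (by omega))
    have hvA : v ∉ A := fun h => hv1 (mem_sup_left h)
    obtain ⟨S, a, b, c⟩ := ih (A ⊔ span F {v})
      (sup_le h ((span_singleton_le_iff_mem _ _).2 hv))
      (fun h => hv1 (gs_exch h1 h)) (fun h => hv2 (gs_exch h2 h)) (by rw [gs_fin A hvA]; omega)
    exact ⟨S, le_sup_left.trans a, b, c⟩

theorem gs_ext' {k : ℕ} {A B : Submodule F V} (hB : k < finrank F B) (m₁ m₂ : V)
    (h : A ≤ B) (h1 : m₁ ∉ A) (h2 : m₂ ∉ A) (hA : finrank F A ≤ k) :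
    ∃ S : Submodule F V, A ≤ S ∧ S ≤ B ∧ finrank F S = k ∧ m₁ ∉ S ∧ m₂ ∉ S :=
  gs_ext B hB m₁ m₂ (k - finrank F A) A h h1 h2 (by omega)

theorem gs_ext3 {k : ℕ} (hk : 2 < k) (hn : k + 2 < finrank F V) {L N : Submodule F V}
    (hL : finrank F L = 2) (hN : finrank F N + 1 = finrank F V) {m₁ m₂ : V}
    (h1 : m₁ ∉ L) (h2 : m₂ ∉ L) :
    ∃ S : Submodule F V, L ≤ S ∧ finrank F S = k ∧ m₁ ∉ S ∧ m₂ ∉ S ∧ ¬ S ≤ N := by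
  have ht : finrank F (⊤ : Submodule F V) = finrank F V := finrank_top F V
  obtain ⟨S, hS, -, hSk, a1, a2⟩ := gs_ext' (k := k - 1) (B := ⊤) (by omega) m₁ m₂
    (le_top (a := L)) h1 h2 (by omega)
  have e1 := gs_fin_le S m₁
  have e2 := gs_fin_le S m₂
  obtain ⟨v, -, hvN, hvA⟩ := gs_cover2 ⊤ N (S ⊔ span F {m₁})
    (gs_not_le (by omega)) (gs_not_le (by omega))
  have key : ∃ v, v ∉ N ∧ v ∉ S ⊔ span F {m₁} ∧ v ∉ S ⊔ span F {m₂} := by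
    by_cases hvB : v ∈ S ⊔ span F {m₂}
    · have e3 := gs_fin_le (S ⊔ span F {m₁}) v
      obtain ⟨u, hu, hu1, hu2⟩ := gs_cover2 N (S ⊔ span F {m₁} ⊔ span F {v}) (S ⊔ span F {m₂})
        (gs_not_le (by omega)) (gs_not_le (by omega))
      refine ⟨v + u, fun h => hvN ?_, fun h => hu1 ?_, fun h => hu2 ?_⟩
      · simpa using N.sub_mem h hu
      · have := Submodule.sub_mem _ (mem_sup_left (T := span F {v}) h)
          (mem_sup_right (mem_span_singleton_self v))
        simpa using this
      · simpa using Submodule.sub_mem _ h hvB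
    · exact ⟨v, hvN, hvA, hvB⟩
  obtain ⟨v, hvN, hvA, hvB⟩ := key
  have hvS : v ∉ S := fun h => hvA (mem_sup_left h)
  refine ⟨S ⊔ span F {v}, hS.trans le_sup_left, by rw [gs_fin S hvS]; omega,
    fun h => hvA (gs_exch a1 h), fun h => hvB (gs_exch a2 h), fun h => hvN ?_⟩
  exact h (mem_sup_right (mem_span_singleton_self v))

/-- one half of the comparison of hyperplanes -/
theorem gs_uniqN {k : ℕ} (hk : 2 < k) (hn : k + 2 < finrank F V) {L N₁ N₂ M₁ M₂ : Submodule F V}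
    (hL : finrank F L = 2) {m₂ : V} (h2 : m₂ ∉ L) (hm₂ : m₂ ∈ M₂)
    (hN₁ : L ≤ N₁ → finrank F N₁ + 1 = finrank F V)
    (h : ∀ S : Submodule F V, finrank F S = k → L ≤ S →
      ((M₁ ≤ S ∨ S ≤ N₁) → (M₂ ≤ S ∨ S ≤ N₂))) (hl : L ≤ N₁) : N₁ ≤ N₂ := by
  by_contra hc
  have hN := hN₁ hl
  have e2 := gs_fin L h2
  obtain ⟨v, hv, hv1, hv2⟩ := gs_cover2 N₁ N₂ (L ⊔ span F {m₂}) hc (gs_not_le (by omega))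
  have hvL : v ∉ L := fun h => hv2 (mem_sup_left h)
  have hmv : m₂ ∉ L ⊔ span F {v} := fun h => hv2 (gs_exch h2 h)
  obtain ⟨S, hS, hSN, hSk, a1, a2⟩ := gs_ext' (k := k) (B := N₁) (by omega) m₂ m₂
    (sup_le hl ((span_singleton_le_iff_mem _ _).2 hv)) hmv hmv (by rw [gs_fin L hvL]; omega)
  rcases h S hSk (le_sup_left.trans hS) (Or.inr hSN) with h | h
  · exact a1 (h hm₂)
  · exact hv1 (h (hS (mem_sup_right (mem_span_singleton_self v))))

theorem gs_uniqM {k : ℕ} (hk : 2 < k) (hn : k + 2 < finrank F V) {L N₁ N₂ M₁ M₂ : Submodule F V}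
    (hL : finrank F L = 2) {m₁ : V} (h1 : m₁ ∉ L) (hM : M₁ = L ⊔ span F {m₁})
    (hMN : ¬ M₁ ≤ N₁) (hN : ∀ S : Submodule F V, L ≤ S → S ≤ N₂ → S ≤ N₁)
    (h : ∀ S : Submodule F V, finrank F S = k → L ≤ S →
      ((M₁ ≤ S ∨ S ≤ N₁) → (M₂ ≤ S ∨ S ≤ N₂))) : M₂ ≤ M₁ := by
  by_contra hc
  obtain ⟨m, hm, hm'⟩ := SetLike.not_le_iff_exists.1 hc
  have ht : finrank F (⊤ : Submodule F V) = finrank F V := finrank_top F V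
  have e := gs_fin L h1
  rw [← hM] at e
  obtain ⟨S, hS, -, hSk, a1, a2⟩ := gs_ext' (k := k) (B := ⊤) (by omega) m m
    (le_top (a := M₁)) hm' hm' (by omega)
  have hLS : L ≤ S := le_trans (by rw [hM]; exact le_sup_left) hS
  rcases h S hSk hLS (Or.inl hS) with h | h
  · exact a1 (h hm)
  · exact hMN (hS.trans (hN S hLS h))

theorem gs_uniq {k : ℕ} (hk : 2 < k) (hn : k + 2 < finrank F V)
    {L N₁ N₂ M₁ M₂ : Submodule F V} {b₁ b₂ : Prop}
    (hL : finrank F L = 2) {m₁ m₂ : V} (h1 : m₁ ∉ L) (h2 : m₂ ∉ L)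
    (hM₁ : M₁ = L ⊔ span F {m₁} ∨ M₁ = ⊤) (hM₂ : M₂ = L ⊔ span F {m₂} ∨ M₂ = ⊤)
    (hN₁ : L ≤ N₁ → finrank F N₁ + 1 = finrank F V)
    (hN₂ : L ≤ N₂ → finrank F N₂ + 1 = finrank F V)
    (hMN₁ : ¬ M₁ ≤ N₁) (hMN₂ : ¬ M₂ ≤ N₂)
    (h : ∀ S : Submodule F V, finrank F S = k → L ≤ S →
      ((b₁ ↔ (M₁ ≤ S ∨ S ≤ N₁)) ↔ (b₂ ↔ (M₂ ≤ S ∨ S ≤ N₂)))) :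
    (b₁ ↔ b₂) ∧ M₁ = M₂ ∧ (L ≤ N₁ → N₁ = N₂) ∧ (L ≤ N₂ → N₂ = N₁) := by
  have ht : finrank F (⊤ : Submodule F V) = finrank F V := finrank_top F V
  have hm₁ : m₁ ∈ M₁ := by
    rcases hM₁ with h | h <;> rw [h]
    · exact mem_sup_right (mem_span_singleton_self _)
    · trivial
  have hm₂ : m₂ ∈ M₂ := by
    rcases hM₂ with h | h <;> rw [h]
    · exact mem_sup_right (mem_span_singleton_self _)
    · trivial
  have hb : b₁ ↔ b₂ := by
    by_contra hb
    have h' : ∀ S : Submodule F V, finrank F S = k → L ≤ S →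
      ((M₁ ≤ S ∨ S ≤ N₁) ↔ ¬ (M₂ ≤ S ∨ S ≤ N₂)) := by
      intro S a b
      exact gs_p1 hb (h S a b)
    have key : ∀ S : Submodule F V, finrank F S = k → L ≤ S → m₁ ∉ S → m₂ ∉ S →
        ¬ S ≤ N₁ → ¬ S ≤ N₂ → False := by
      intro S a b c d e g
      have := h' S a b
      have q1 : ¬ M₁ ≤ S := fun h => c (h hm₁)
      have q2 : ¬ M₂ ≤ S := fun h => d (h hm₂)
      exact (not_or.2 ⟨q1, e⟩) ((this).2 (not_or.2 ⟨q2, g⟩))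
    by_cases l1 : L ≤ N₁
    · by_cases l2 : L ≤ N₂
      · have e1 := hN₁ l1
        have e2 := hN₂ l2
        have e3 := finrank_sup_add_finrank_inf_eq N₁ N₂
        have e4 := Submodule.finrank_le (N₁ ⊔ N₂)
        obtain ⟨S, hS, hSN, hSk, -, -⟩ := gs_ext' (k := k) (B := N₁ ⊓ N₂) (by omega) m₁ m₂
          (le_inf l1 l2) h1 h2 (by omega)
        have := h' S hSk hS
        have q1 := hSN.trans inf_le_left
        have q2 := hSN.trans inf_le_right
        exact this.1 (Or.inr q1) (Or.inr q2)
      · obtain ⟨S, a, b, c, d, e⟩ := gs_ext3 hk hn hL (hN₁ l1) h1 h2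
        exact key S b a c d e (fun h => l2 (a.trans h))
    · by_cases l2 : L ≤ N₂
      · obtain ⟨S, a, b, c, d, e⟩ := gs_ext3 hk hn hL (hN₂ l2) h1 h2
        exact key S b a c d (fun h => l1 (a.trans h)) e
      · obtain ⟨S, a, -, b, c, d⟩ := gs_ext' (k := k) (B := ⊤) (by omega) m₁ m₂
          (le_top (a := L)) h1 h2 (by omega)
        exact key S b a c d (fun h => l1 (a.trans h)) (fun h => l2 (a.trans h))
  have h' : ∀ S : Submodule F V, finrank F S = k → L ≤ S →
      ((M₁ ≤ S ∨ S ≤ N₁) ↔ (M₂ ≤ S ∨ S ≤ N₂)) := by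
    intro S a b
    exact gs_p2 hb (h S a b)
  have n1 : L ≤ N₁ → N₁ = N₂ := fun l => by
    have q := gs_uniqN hk hn hL h2 hm₂ hN₁ (fun S a b => (h' S a b).1) l
    exact eq_of_le_of_finrank_eq q (by have := hN₁ l; have := hN₂ (l.trans q); omega)
  have n2 : L ≤ N₂ → N₂ = N₁ := fun l => by
    have q := gs_uniqN hk hn hL h1 hm₁ hN₂ (fun S a b => (h' S a b).2) l
    exact eq_of_le_of_finrank_eq q (by have := hN₂ l; have := hN₁ (l.trans q); omega)
  refine ⟨hb, ?_, n1, n2⟩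
  have a1 : M₁ = L ⊔ span F {m₁} → M₂ ≤ M₁ := fun hM =>
    gs_uniqM hk hn hL h1 hM hMN₁ (fun S a b => by rw [← n2 (a.trans b)]; exact b)
      (fun S a b => (h' S a b).1)
  have a2 : M₂ = L ⊔ span F {m₂} → M₁ ≤ M₂ := fun hM =>
    gs_uniqM hk hn hL h2 hM hMN₂ (fun S a b => by rw [← n1 (a.trans b)]; exact b)
      (fun S a b => (h' S a b).2)
  have f1 := gs_fin L h1
  have f2 := gs_fin L h2
  rcases hM₁ with e1 | e1 <;> rcases hM₂ with e2 | e2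
  · exact le_antisymm (a2 e2) (a1 e1)
  · have := a1 e1
    rw [e2, e1] at this
    exact absurd this (gs_not_le (by omega))
  · have := a2 e2
    rw [e2, e1] at this
    exact absurd this (gs_not_le (by omega))
  · rw [e1, e2]

/-- the linear algebra lemma: a system of pairwise coplanar lines has a common point -/
theorem gs_center {x : V} {P T : Submodule F V} (hP : finrank F P = 2) 
    (hT : 3 < finrank F T) (Q : V → Submodule F V)
    (h1 : ∀ y ∈ T, y ∉ P → finrank F (Q y) = 2 ∧ y ∈ Q y ∧ x ∉ Q y ∧ Q y ≤ P ⊔ span F {y})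
    (h2 : ∀ y ∈ T, y ∉ P → ∀ y' ∈ T, y' ∉ P → y' ∉ Q y → Q y' ≤ Q y ⊔ span F {y'}) :
    ∃ z ∈ P, z ∉ span F {x} ∧ ∀ y ∈ T, y ∉ P → z ∈ Q y := by
  obtain ⟨y₀, hy₀, hy₀P⟩ := SetLike.not_le_iff_exists.1 (gs_not_le (A := T) (B := P) (by omega))
  obtain ⟨q1, q2, q3, q4⟩ := h1 y₀ hy₀ hy₀P
  have e0 := gs_fin P hy₀P
  have hz : ∃ z ∈ P ⊓ Q y₀, z ≠ 0 := by
    apply (Submodule.ne_bot_iff _).1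
    intro hb
    have a := finrank_sup_add_finrank_inf_eq P (Q y₀)
    rw [hb, finrank_bot] at a
    have b := finrank_mono (sup_le (le_sup_left (a := P) (b := span F {y₀})) q4)
    omega
  obtain ⟨z, ⟨hzP, hzQ⟩, hz0⟩ := hz
  have hzx : z ∉ span F {x} := by
    intro h
    obtain ⟨c, rfl⟩ := mem_span_singleton.1 h
    have hc : c ≠ 0 := by rintro rfl; simp at hz0
    exact q3 (((Q y₀).smul_mem_iff hc).1 hzQ)
  have claim : ∀ y₀ ∈ T, y₀ ∉ P → z ∈ Q y₀ → ∀ y ∈ T, y ∉ P ⊔ span F {y₀} → z ∈ Q y := by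
    intro y₀ hy₀ hy₀P hzQ y hy hyP
    obtain ⟨q1, q2, q3, q4⟩ := h1 y₀ hy₀ hy₀P
    have hyP' : y ∉ P := fun h => hyP (mem_sup_left h)
    obtain ⟨r1, r2, r3, r4⟩ := h1 y hy hyP'
    have hyQ : y ∉ Q y₀ := fun h => hyP (q4 h)
    have s4 := h2 y₀ hy₀ hy₀P y hy hyP' hyQ
    have i1 := gs_fin P hyP'
    have i2 := gs_fin (Q y₀) hyQ
    have i3 := gs_fin _ hyP
    have i4 := gs_fin P hy₀P
    have i5 := finrank_sup_add_finrank_inf_eq (P ⊔ span F {y}) (Q y₀ ⊔ span F {y})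
    have i6 : P ⊔ span F {y₀} ⊔ span F {y} ≤ (P ⊔ span F {y}) ⊔ (Q y₀ ⊔ span F {y}) := by
      refine sup_le (sup_le (le_sup_left.trans le_sup_left) ?_) (le_sup_right.trans le_sup_left)
      rw [span_singleton_le_iff_mem]
      exact mem_sup_right (mem_sup_left q2)
    have i7 := finrank_mono i6
    have i8 := eq_of_le_of_finrank_le (le_inf r4 s4) (by omega)
    rw [i8]
    exact ⟨mem_sup_left hzP, mem_sup_left hzQ⟩
  obtain ⟨y₁, hy₁, hy₁P⟩ := SetLike.not_le_iff_exists.1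
    (gs_not_le (A := T) (B := P ⊔ span F {y₀}) (by omega))
  have hy₁P' : y₁ ∉ P := fun h => hy₁P (mem_sup_left h)
  refine ⟨z, hzP, hzx, fun y hy hyP => ?_⟩
  by_cases c0 : y ∈ P ⊔ span F {y₀}
  · by_cases c1 : y ∈ P ⊔ span F {y₁}
    · exfalso
      have := gs_exch hyP c1
      have h3 : P ⊔ span F {y} ≤ P ⊔ span F {y₀} :=
        sup_le le_sup_left ((span_singleton_le_iff_mem _ _).2 c0)
      exact hy₁P (h3 this)
    · exact claim y₁ hy₁ hy₁P' (claim y₀ hy₀ hy₀P hzQ y₁ hy₁ hy₁P) y hy c1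
  · exact claim y₀ hy₀ hy₀P hzQ y hy c0

/-- local description of `Φ` on the `k`-spaces through `x` -/
def GSLoc (F : Type*) {V : Type*} [Field F] [AddCommGroup V] [Module F V]
    (k : ℕ) (Φ : Submodule F V → Prop) (x : V) (b : Prop) (P N : Submodule F V) : Prop :=
  x ∈ P ∧ (P = ⊤ ∨ finrank F P = 2) ∧ (N = ⊥ ∨ (finrank F N + 1 = finrank F V ∧ x ∈ N)) ∧
  ¬ P ≤ N ∧ ∀ S : Submodule F V, finrank F S = k → x ∈ S → (Φ S ↔ (b ↔ (P ≤ S ∨ S ≤ N)))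

theorem gs_line {P : Submodule F V} (hP : finrank F P = 2) {x y : V} (hx : x ∈ P) (hy : y ∈ P)
    (hx0 : x ≠ 0) (hyx : y ∉ span F {x}) : P = span F {x} ⊔ span F {y} := by
  symm
  apply eq_of_le_of_finrank_eq
  · exact sup_le ((span_singleton_le_iff_mem _ _).2 hx) ((span_singleton_le_iff_mem _ _).2 hy)
  · rw [gs_fin _ hyx, finrank_span_singleton hx0, hP]

theorem gs_norm {L P : Submodule F V} {x : V} (hL : finrank F L = 2) (hx0 : x ≠ 0)
    (hV : 2 < finrank F V) (hxL : x ∈ L) (hxP : x ∈ P)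
    (hP : P = ⊤ ∨ finrank F P = 2) (hPL : P ≠ L) :
    ∃ m, m ∉ L ∧ (L ⊔ P = L ⊔ span F {m} ∨ L ⊔ P = ⊤) := by
  have ht : finrank F (⊤ : Submodule F V) = finrank F V := finrank_top F V
  rcases hP with rfl | hP
  · obtain ⟨m, -, hm⟩ := SetLike.not_le_iff_exists.1
      (gs_not_le (A := (⊤ : Submodule F V)) (B := L) (by omega))
    exact ⟨m, hm, Or.inr (by simp)⟩
  · have : ¬ P ≤ L := fun h => hPL (eq_of_le_of_finrank_eq h (by omega))
    obtain ⟨m, hm, hmL⟩ := SetLike.not_le_iff_exists.1 this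
    refine ⟨m, hmL, Or.inl ?_⟩
    have hmx : m ∉ span F {x} := fun h => hmL ((span_singleton_le_iff_mem _ _).2 hxL h)
    rw [gs_line hP hxP hm hx0 hmx, ← sup_assoc, sup_eq_left.2 ((span_singleton_le_iff_mem _ _).2 hxL)]

theorem gs_step {k : ℕ} (hk : 2 < k) (hn : k + 2 < finrank F V) {Φ : Submodule F V → Prop}
    {x y : V} {b b' : Prop} {P N P' N' : Submodule F V} (hx0 : x ≠ 0)
    (hy : y ∉ span F {x}) (h : GSLoc F k Φ x b P N) (h' : GSLoc F k Φ y b' P' N')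
    (hPL : P ≠ span F {x} ⊔ span F {y})
    (hne : finrank F P = 2 ∨ span F {x} ⊔ span F {y} ≤ N) :
    (b ↔ b') ∧ P' ≠ span F {x} ⊔ span F {y} ∧
    (span F {x} ⊔ span F {y}) ⊔ P = (span F {x} ⊔ span F {y}) ⊔ P' ∧
    (span F {x} ⊔ span F {y} ≤ N → N = N') ∧ (span F {x} ⊔ span F {y} ≤ N' → N' = N) := by
  have ht : finrank F (⊤ : Submodule F V) = finrank F V := finrank_top F V
  have hL : finrank F ↥(span F {x} ⊔ span F {y}) = 2 := by
    rw [gs_fin _ hy, finrank_span_singleton hx0]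
  have hxL : x ∈ span F {x} ⊔ span F {y} := mem_sup_left (mem_span_singleton_self x)
  have hyL : y ∈ span F {x} ⊔ span F {y} := mem_sup_right (mem_span_singleton_self y)
  have hy0 : y ≠ 0 := by rintro rfl; exact hy (zero_mem _)
  generalize span F {x} ⊔ span F {y} = L at *
  obtain ⟨a1, a2, a3, a4, a5⟩ := h
  obtain ⟨c1, c2, c3, c4, c5⟩ := h'
  obtain ⟨m, hm, hM⟩ := gs_norm hL hx0 (by omega) hxL a1 a2 hPL
  have hbot : ¬ L ≤ ⊥ := gs_not_le (by rw [finrank_bot]; omega)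
  have hN : L ≤ N → finrank F N + 1 = finrank F V := by
    intro hl
    rcases a3 with rfl | a3
    · exact absurd hl hbot
    · exact a3.1
  have hN' : L ≤ N' → finrank F N' + 1 = finrank F V := by
    intro hl
    rcases c3 with rfl | c3
    · exact absurd hl hbot
    · exact c3.1
  have sup_iff : ∀ S P : Submodule F V, L ≤ S → (P ≤ S ↔ L ⊔ P ≤ S) := by
    intro S P hS
    rw [sup_le_iff]; simp [hS]
  by_cases hP' : P' = L
  · exfalso
    have := gs_uniq (b₁ := b) (b₂ := ¬ b') (M₂ := ⊤) (N₂ := ⊥) hk hn hL hm hm hM (Or.inr rfl) hN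
      (fun h => absurd h hbot) (fun h => a4 (le_sup_right.trans h))
      (gs_not_le (by rw [finrank_bot]; omega))
      (by
        intro S hS hLS
        have e1 := a5 S hS (hLS hxL)
        have e2 := c5 S hS (hLS hyL)
        rw [sup_iff S P hLS] at e1
        rw [hP'] at e2
        have e3 : ¬ (⊤ : Submodule F V) ≤ S := gs_not_le (by omega)
        have e4 : ¬ S ≤ ⊥ := fun h => hbot (hLS.trans h)
        simp only [hLS, e3, e4] at e1 e2 ⊢
        rw [← e1, e2]; simp)
    obtain ⟨-, u1, u2, -⟩ := this
    rcases hne with hne | hne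
    · have := finrank_add_le_finrank_add_finrank L P
      rw [u1] at this
      omega
    · rw [u2 hne] at hne
      exact hbot hne
  · obtain ⟨m', hm', hM'⟩ := gs_norm hL hy0 (by omega) hyL c1 c2 hP'
    have := gs_uniq (b₁ := b) (b₂ := b') hk hn hL hm hm' hM hM' hN hN'
      (fun h => a4 (le_sup_right.trans h)) (fun h => c4 (le_sup_right.trans h))
      (by
        intro S hS hLS
        have e1 := a5 S hS (hLS hxL)
        have e2 := c5 S hS (hLS hyL)
        rw [sup_iff S P hLS] at e1
        rw [sup_iff S P' hLS] at e2
        rw [← e1, e2])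
    exact ⟨this.1, hP', this.2⟩

/-- conclusion in coordinates-free form -/
def GSPat (F : Type*) {V : Type*} [Field F] [AddCommGroup V] [Module F V]
    (k : ℕ) (Φ : Submodule F V → Prop) : Prop :=
  (∃ p : Submodule F V, finrank F p = 1 ∧ ∀ S : Submodule F V, finrank F S = k → (Φ S ↔ p ≤ S)) ∨
  (∃ N : Submodule F V, finrank F N + 1 = finrank F V ∧ ∀ S : Submodule F V, finrank F S = k → (Φ S ↔ S ≤ N)) ∨
  (∃ p N : Submodule F V, finrank F p = 1 ∧ finrank F N + 1 = finrank F V ∧ ¬ p ≤ N ∧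
    ∀ S : Submodule F V, finrank F S = k → (Φ S ↔ (p ≤ S ∨ S ≤ N)))

/-- common part: find the centre -/
theorem gs_core {k : ℕ} (hk : 2 < k) (hn : k + 2 < finrank F V) {Φ : Submodule F V → Prop}
    {b : V → Prop} {P N : V → Submodule F V}
    (hloc : ∀ x, x ≠ 0 → GSLoc F k Φ x (b x) (P x) (N x)) {x : V} (hx0 : x ≠ 0)
    (hP : finrank F (P x) = 2) (T : Submodule F V) (hT : 3 < finrank F T) (hb : b x) :
    ∃ z ∈ P x, z ∉ span F {x} ∧ ∀ y ∈ T, y ∉ P x → b y ∧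
      ∀ S, y ∈ S → (P y ≤ S ↔ z ∈ S) := by
  have hne0 : ∀ y, y ∉ P x → y ≠ 0 := by rintro y hy rfl; exact hy (zero_mem _)
  have line : ∀ x y, x ≠ 0 → finrank F (P x) = 2 → y ∉ P x →
      (b x ↔ b y) ∧ finrank F (P y) = 2 ∧ x ∉ P y ∧ P y ≤ P x ⊔ span F {y} := by
    intro x y hx0 hP hyP
    have hy0 : y ≠ 0 := by rintro rfl; exact hyP (zero_mem _)
    have hx := hloc x hx0
    have hy := hloc y hy0
    have hyx : y ∉ span F {x} := fun h => hyP ((span_singleton_le_iff_mem _ _).2 hx.1 h)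
    obtain ⟨s1, s2, s3, -⟩ := gs_step hk hn hx0 hyx hx hy
      (fun h => hyP (by rw [h]; exact mem_sup_right (mem_span_singleton_self y))) (Or.inl hP)
    have e : span F {x} ⊔ span F {y} ⊔ P x = P x ⊔ span F {y} := by
      rw [sup_right_comm, sup_eq_right.2 ((span_singleton_le_iff_mem _ _).2 hx.1)]
    have hle : P y ≤ P x ⊔ span F {y} := by rw [← e, s3]; exact le_sup_right
    have f2 : finrank F (P y) = 2 := by
      rcases hy.2.1 with h | h
      · have ht : finrank F (⊤ : Submodule F V) = finrank F V := finrank_top F V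
        have := finrank_mono hle
        rw [gs_fin _ hyP, h] at this
        omega
      · exact h
    refine ⟨s1, f2, fun h => s2 ?_, hle⟩
    have hxy : x ∉ span F {y} := by
      intro h
      obtain ⟨c, rfl⟩ := mem_span_singleton.1 h
      have hc : c ≠ 0 := by rintro rfl; simp at hx0
      exact hyP (((P (c • y)).smul_mem_iff hc).1 hx.1)
    rw [gs_line f2 hy.1 h hy0 hxy, sup_comm]
  obtain ⟨z, hz, hzx, hzT⟩ := gs_center (x := x) hP hT P
    (fun y _ hyP => by
      obtain ⟨-, l2, l3, l4⟩ := line x y hx0 hP hyP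
      exact ⟨l2, (hloc y (hne0 y hyP)).1, l3, l4⟩)
    (fun y _ hyP y' _ hyP' hyy => 
      (line y y' (hne0 y hyP) (line x y hx0 hP hyP).2.1 hyy).2.2.2)
  refine ⟨z, hz, hzx, fun y hy hyP => ?_⟩
  obtain ⟨l1, l2, l3, l4⟩ := line x y hx0 hP hyP
  refine ⟨l1.1 hb, fun S hyS => ⟨fun h => h (hzT y hy hyP), fun h => ?_⟩⟩
  have hzy : z ∉ span F {y} := by
    intro h
    obtain ⟨c, rfl⟩ := mem_span_singleton.1 h
    have hc : c ≠ 0 := by rintro rfl; simp at hzx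
    exact hyP (((P x).smul_mem_iff hc).1 hz)
  rw [gs_line l2 (hloc y (hne0 y hyP)).1 (hzT y hy hyP) (hne0 y hyP) hzy]
  exact sup_le ((span_singleton_le_iff_mem _ _).2 hyS) ((span_singleton_le_iff_mem _ _).2 h)

theorem gs_caseA {k : ℕ} (hk : 2 < k) (hn : k + 2 < finrank F V) {Φ : Submodule F V → Prop}
    {b : V → Prop} {P N : V → Submodule F V}
    (hloc : ∀ x, x ≠ 0 → GSLoc F k Φ x (b x) (P x) (N x)) {x : V} (hx0 : x ≠ 0)
    (hN : N x ≠ ⊥) (hb : b x) : GSPat F k Φ := by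
  have ht : finrank F (⊤ : Submodule F V) = finrank F V := finrank_top F V
  have hx := hloc x hx0
  obtain ⟨hN1, hxN⟩ := hx.2.2.1.resolve_left hN
  have pick : ∀ S : Submodule F V, finrank F S = k → ∃ y ∈ S, y ∈ N x ∧ y ∉ span F {x} := by
    intro S hS
    have e1 := finrank_sup_add_finrank_inf_eq S (N x)
    have e2 := Submodule.finrank_le (S ⊔ N x)
    have e3 : finrank F (span F {x}) = 1 := finrank_span_singleton hx0
    obtain ⟨y, hy, hy'⟩ := SetLike.not_le_iff_exists.1
      (gs_not_le (A := S ⊓ N x) (B := span F {x}) (by omega))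
    exact ⟨y, hy.1, hy.2, hy'⟩
  have hstep : ∀ y ∈ N x, y ∉ span F {x} → (b x ↔ b y) ∧ N y = N x ∧
      (span F {x} ⊔ span F {y}) ⊔ P x = (span F {x} ⊔ span F {y}) ⊔ P y := by
    intro y hyN hyx
    have hy0 : y ≠ 0 := by rintro rfl; exact hyx (zero_mem _)
    have hle : span F {x} ⊔ span F {y} ≤ N x :=
      sup_le ((span_singleton_le_iff_mem _ _).2 hxN) ((span_singleton_le_iff_mem _ _).2 hyN)
    obtain ⟨s1, s2, s3, s4, s5⟩ := gs_step hk hn hx0 hyx hx (hloc y hy0)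
      (fun h => hx.2.2.2.1 (by rw [h]; exact hle)) (Or.inr hle)
    exact ⟨s1, (s4 hle).symm, s3⟩
  rcases hx.2.1 with hP | hP
  · refine Or.inr (Or.inl ⟨N x, hN1, fun S hS => ?_⟩)
    obtain ⟨y, hyS, hyN, hyx⟩ := pick S hS
    have hy0 : y ≠ 0 := by rintro rfl; exact hyx (zero_mem _)
    obtain ⟨s1, s2, s3⟩ := hstep y hyN hyx
    have hy := hloc y hy0
    rw [hy.2.2.2.2 S hS hyS, s2]
    have hPy : P y = ⊤ := by
      rcases hy.2.1 with h | h
      · exact h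
      · exfalso
        have q1 := finrank_add_le_finrank_add_finrank (span F {x} ⊔ span F {y}) (P y)
        have q2 := gs_fin_le (span F {x}) y
        rw [finrank_span_singleton hx0] at q2
        rw [← s3, hP, sup_top_eq] at q1
        omega
    have e3 : ¬ (⊤ : Submodule F V) ≤ S := gs_not_le (by omega)
    simp only [hPy, e3, s1.1 hb, false_or, true_iff]
  · obtain ⟨z, hz, hzx, hzT⟩ := gs_core hk hn hloc hx0 hP (N x) (by omega) hb
    have hz0 : z ≠ 0 := by rintro rfl; exact hzx (zero_mem _)
    refine Or.inr (Or.inr ⟨span F {z}, N x, finrank_span_singleton hz0, hN1, ?_, ?_⟩)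
    · intro h
      apply hx.2.2.2.1
      rw [gs_line hP hx.1 hz hx0 hzx]
      exact sup_le ((span_singleton_le_iff_mem _ _).2 hxN) h
    · intro S hS
      obtain ⟨y, hyS, hyN, hyx⟩ := pick S hS
      have hy0 : y ≠ 0 := by rintro rfl; exact hyx (zero_mem _)
      obtain ⟨s1, s2, s3⟩ := hstep y hyN hyx
      have hyP : y ∉ P x := by
        intro h
        apply hx.2.2.2.1
        rw [gs_line hP hx.1 h hx0 hyx]
        exact sup_le ((span_singleton_le_iff_mem _ _).2 hxN) ((span_singleton_le_iff_mem _ _).2 hyN)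
      obtain ⟨t1, t2⟩ := hzT y hyN hyP
      rw [(hloc y hy0).2.2.2.2 S hS hyS, s2, t2 S hyS, span_singleton_le_iff_mem]
      simp only [t1, true_iff]

theorem gs_caseB {k : ℕ} (hk : 2 < k) (hn : k + 2 < finrank F V) {Φ : Submodule F V → Prop}
    {b : V → Prop} {P N : V → Submodule F V}
    (hloc : ∀ x, x ≠ 0 → GSLoc F k Φ x (b x) (P x) (N x)) {x : V} (hx0 : x ≠ 0)
    (hN : ∀ x, x ≠ 0 → N x = ⊥) (hP : P x ≠ ⊤) (hb : b x) : GSPat F k Φ := by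
  have ht : finrank F (⊤ : Submodule F V) = finrank F V := finrank_top F V
  have hx := hloc x hx0
  have hP := hx.2.1.resolve_left hP
  obtain ⟨z, hz, hzx, hzT⟩ := gs_core hk hn hloc hx0 hP ⊤ (by omega) hb
  have hz0 : z ≠ 0 := by rintro rfl; exact hzx (zero_mem _)
  refine Or.inl ⟨span F {z}, finrank_span_singleton hz0, ?_⟩
  intro S hS
  obtain ⟨y, hyS, hyP⟩ := SetLike.not_le_iff_exists.1
    (gs_not_le (A := S) (B := P x) (by omega))
  have hy0 : y ≠ 0 := by rintro rfl; exact hyP (zero_mem _)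
  obtain ⟨t1, t2⟩ := hzT y trivial hyP
  have e4 : ¬ S ≤ ⊥ := gs_not_le (by rw [finrank_bot]; omega)
  rw [(hloc y hy0).2.2.2.2 S hS hyS, hN y hy0, t2 S hyS, span_singleton_le_iff_mem]
  simp only [t1, true_iff, e4, or_false]

theorem GSLoc.compl {k : ℕ} {Φ : Submodule F V → Prop} {x : V} {b : Prop} {P N : Submodule F V}
    (h : GSLoc F k Φ x b P N) : GSLoc F k (fun S => ¬ Φ S) x (¬ b) P N := by
  obtain ⟨h1, h2, h3, h4, h5⟩ := h
  refine ⟨h1, h2, h3, h4, fun S hS hx => ?_⟩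
  have := h5 S hS hx
  show ¬ Φ S ↔ _
  rw [this]
  tauto

theorem gs_main {k : ℕ} (hk : 2 < k) (hn : k + 2 < finrank F V) {Φ : Submodule F V → Prop}
    (hloc : ∀ x : V, x ≠ 0 → ∃ b P N, GSLoc F k Φ x b P N) :
    GSPat F k Φ ∨ GSPat F k (fun S => ¬ Φ S) ∨ (∀ S : Submodule F V, finrank F S = k → Φ S) ∨
      (∀ S : Submodule F V, finrank F S = k → ¬ Φ S) := by
  have ht : finrank F (⊤ : Submodule F V) = finrank F V := finrank_top F V
  have : ∀ x : V, ∃ b P N, x ≠ 0 → GSLoc F k Φ x b P N := by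
    intro x
    by_cases hx : x = 0
    · exact ⟨True, ⊤, ⊥, fun h => absurd hx h⟩
    · obtain ⟨b, P, N, h⟩ := hloc x hx
      exact ⟨b, P, N, fun _ => h⟩
  choose b P N h using this
  have h' := fun x hx => (h x hx).compl
  by_cases hA : ∃ x, x ≠ 0 ∧ N x ≠ ⊥
  · obtain ⟨x, hx0, hN⟩ := hA
    by_cases hb : b x
    · exact Or.inl (gs_caseA hk hn h hx0 hN hb)
    · exact Or.inr (Or.inl (gs_caseA (b := fun x => ¬ b x) hk hn h' hx0 hN hb))
  push Not at hA
  by_cases hB : ∃ x, x ≠ 0 ∧ P x ≠ ⊤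
  · obtain ⟨x, hx0, hP⟩ := hB
    by_cases hb : b x
    · exact Or.inl (gs_caseB hk hn h hx0 hA hP hb)
    · exact Or.inr (Or.inl (gs_caseB (b := fun x => ¬ b x) hk hn h' hx0 hA hP hb))
  push Not at hB
  right; right
  have hv : ∀ S : Submodule F V, finrank F S = k → ∀ x ∈ S, x ≠ 0 → (Φ S ↔ ¬ b x) := by
    intro S hS x hx hx0
    have e3 : ¬ (⊤ : Submodule F V) ≤ S := gs_not_le (by omega)
    have e4 : ¬ S ≤ ⊥ := gs_not_le (by rw [finrank_bot]; omega)
    rw [(h x hx0).2.2.2.2 S hS hx, hA x hx0, hB x hx0]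
    simp [e3, e4]
  have nz : ∀ S : Submodule F V, finrank F S = k → ∃ x ∈ S, x ≠ 0 := by
    intro S hS
    apply (Submodule.ne_bot_iff _).1
    rintro rfl
    rw [finrank_bot] at hS
    omega
  have hconst : ∀ S S' : Submodule F V, finrank F S = k → finrank F S' = k → Φ S → Φ S' := by
    intro S S' hS hS' hΦ
    obtain ⟨x, hx, hx0⟩ := nz S hS
    obtain ⟨y, hy, hy0⟩ := nz S' hS'
    have q2 := gs_fin_le (span F {x}) y
    rw [finrank_span_singleton hx0] at q2
    obtain ⟨m, -, hm⟩ := SetLike.not_le_iff_exists.1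
      (gs_not_le (A := (⊤ : Submodule F V)) (B := span F {x} ⊔ span F {y}) (by omega))
    obtain ⟨R, hR, -, hRk, -⟩ := gs_ext' (k := k) (B := ⊤) (by omega) m m
      (le_top (a := span F {x} ⊔ span F {y})) hm hm (by omega)
    have r1 := hv R hRk x (hR (mem_sup_left (mem_span_singleton_self x))) hx0
    have r2 := hv R hRk y (hR (mem_sup_right (mem_span_singleton_self y))) hy0
    rw [hv S' hS' y hy hy0, ← r2, r1, ← hv S hS x hx hx0]
    exact hΦ
  by_cases hex : ∃ S : Submodule F V, finrank F S = k ∧ Φ S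
  · obtain ⟨S, hS, hΦ⟩ := hex
    exact Or.inl fun S' hS' => hconst S S' hS hS' hΦ
  · push Not at hex
    exact Or.inr hex

end GSaux

section GSfinal
open Submodule

theorem gs_proj {F V W : Type*} [Field F] [AddCommGroup V] [Module F V] [FiniteDimensional F V]
    [AddCommGroup W] [Module F W] [FiniteDimensional F W]
    (h : finrank F W + 1 = finrank F V) {x : V} (hx : x ≠ 0) :
    ∃ φ : V →ₗ[F] W, Function.Surjective φ ∧ LinearMap.ker φ = span F {x} := by
  have e1 := Submodule.finrank_quotient_add_finrank (span F {x})
  rw [finrank_span_singleton hx] at e1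
  let e : (V ⧸ span F {x}) ≃ₗ[F] W := LinearEquiv.ofFinrankEq _ _ (by omega)
  refine ⟨e.toLinearMap ∘ₗ (span F {x}).mkQ, ?_, ?_⟩
  · exact e.surjective.comp (Submodule.mkQ_surjective _)
  · rw [LinearEquiv.ker_comp, Submodule.ker_mkQ]

theorem gs_comap_fin {F V W : Type*} [Field F] [AddCommGroup V] [Module F V]
    [FiniteDimensional F V] [AddCommGroup W] [Module F W] [FiniteDimensional F W]
    {x : V} (hx : x ≠ 0) {φ : V →ₗ[F] W} (hs : Function.Surjective φ)
    (hker : LinearMap.ker φ = span F {x}) (T : Submodule F W) :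
    finrank F (T.comap φ) = finrank F T + 1 := by
  have h1 := LinearMap.finrank_range_add_finrank_ker (φ.domRestrict (T.comap φ))
  rw [LinearMap.range_domRestrict, map_comap_eq_of_surjective hs, LinearMap.ker_domRestrict] at h1
  have h2 : finrank F ((LinearMap.ker φ).comap (T.comap φ).subtype) = 1 := by
    have : finrank F (LinearMap.ker φ) = 1 := by rw [hker, finrank_span_singleton hx]
    rw [← this]
    exact (Submodule.comapSubtypeEquivOfLe (LinearMap.ker_le_comap φ)).finrank_eq
  rw [← h1]
  congr 1

theorem gs_deg {F : Type*} [Field F] [Fintype F] {n k : ℕ} 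
    (f : Gr F n k → Bool) (hf : GrDegOne f) {m l : ℕ} {x : Fin n → F} (hx : x ≠ 0)
    {φ : (Fin n → F) →ₗ[F] (Fin m → F)}
    (hker : LinearMap.ker φ = span F {x})
    (g : Gr F m l → Bool)
    (hg : ∀ T : Gr F m l, ∃ h : finrank F (T.val.comap φ) = k, g T = f ⟨T.val.comap φ, h⟩) :
    GrDegOne g := by
  obtain ⟨c, C, hC⟩ := hf
  let A : Finset (Submodule F (Fin n → F)) := Finset.univ.filter fun p => finrank F p = 1
  let B : Finset (Submodule F (Fin m → F)) := Finset.univ.filter fun p => finrank F p = 1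
  let A' := A.erase (span F {x})
  have hxA : span F {x} ∈ A := by simp [A, finrank_span_singleton hx]
  have hmap : ∀ p ∈ A', p.map φ ∈ B := by
    intro p hp
    simp only [A', A, Finset.mem_erase, Finset.mem_filter, Finset.mem_univ, true_and] at hp
    simp only [B, Finset.mem_filter, Finset.mem_univ, true_and]
    obtain ⟨v, hv0, hv⟩ := finrank_eq_one_iff'.1 hp.2
    have hpv : p = span F {(v : Fin n → F)} := by
      symm
      apply eq_of_le_of_finrank_eq
      · rw [span_singleton_le_iff_mem]; exact v.2
      · rw [hp.2, finrank_span_singleton (by simpa using hv0)]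
    rw [hpv, map_span, Set.image_singleton]
    apply finrank_span_singleton
    intro h0
    apply hp.1
    have : (v : Fin n → F) ∈ LinearMap.ker φ := h0
    rw [hker] at this
    apply eq_of_le_of_finrank_eq
    · rw [hpv, span_singleton_le_iff_mem]; exact this
    · rw [hp.2, finrank_span_singleton hx]
  refine ⟨c + C (span F {x}), fun p' => ∑ p ∈ A' with p.map φ = p', C p, fun T => ?_⟩
  obtain ⟨hk, hgT⟩ := hg T
  rw [hgT]
  refine (hC ⟨_, hk⟩).trans ?_
  have e1 : ∀ G : Submodule F (Fin n → F) → ℝ,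
      (∑ᶠ p ∈ {p : Submodule F (Fin n → F) | finrank F p = 1}, G p) = ∑ p ∈ A, G p := by
    intro G
    rw [← finsum_mem_coe_finset]
    simp [A]
  have e2 : ∀ G : Submodule F (Fin m → F) → ℝ,
      (∑ᶠ p ∈ {p : Submodule F (Fin m → F) | finrank F p = 1}, G p) = ∑ p ∈ B, G p := by
    intro G
    rw [← finsum_mem_coe_finset]
    simp [B]
  rw [e1, e2, ← Finset.add_sum_erase A _ hxA]
  have hxT : span F {x} ≤ T.val.comap φ := by
    rw [← hker]; exact LinearMap.ker_le_comap φ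
  simp only [hxT, if_true, mul_one]
  rw [add_assoc]
  congr 2
  rw [← Finset.sum_fiberwise_of_maps_to hmap]
  apply Finset.sum_congr rfl
  intro p' _
  rw [Finset.sum_mul]
  apply Finset.sum_congr rfl
  intro p hp
  have := (Finset.mem_filter.1 hp).2
  rw [← this]
  simp only [map_le_iff_le_comap]

theorem gs_local {F : Type*} [Field F] [Fintype F] {n k : ℕ} (hk : 2 < k) (hnk : 2 < n - k)
    (H : ∀ g : Gr F (n - 1) (k - 1) → Bool, GrDegOne g → GrTrivial g)
    (f : Gr F n k → Bool) (hf : GrDegOne f) (x : Fin n → F) (hx : x ≠ 0) :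
    ∃ b P N, GSLoc F k (fun S => ∃ h : finrank F S = k, f ⟨S, h⟩ = true) x b P N := by
  have hV : finrank F (Fin n → F) = n := by simp
  have hW : finrank F (Fin (n - 1) → F) = n - 1 := by simp
  have ht : finrank F (⊤ : Submodule F (Fin n → F)) = n := by rw [finrank_top, hV]
  obtain ⟨φ, hs, hker⟩ := gs_proj (F := F) (V := Fin n → F) (W := Fin (n - 1) → F)
    (by omega) hx
  have hcf := gs_comap_fin hx hs hker
  have hc : ∀ T : Gr F (n - 1) (k - 1), finrank F (T.val.comap φ) = k := by
    intro T
    rw [hcf, T.2]; omega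
  have hxc : ∀ T : Submodule F (Fin (n - 1) → F), x ∈ T.comap φ := by
    intro T
    have : x ∈ LinearMap.ker φ := by rw [hker]; exact mem_span_singleton_self x
    exact LinearMap.ker_le_comap φ this
  let g : Gr F (n - 1) (k - 1) → Bool := fun T => f ⟨T.val.comap φ, hc T⟩
  have hg := H g (gs_deg f hf hx hker g (fun T => ⟨hc T, rfl⟩))
  have hlift : ∀ S : Submodule F (Fin n → F), finrank F S = k → x ∈ S →
      ∃ T : Gr F (n - 1) (k - 1), S = T.val.comap φ := by
    intro S hS hxS
    have e : (S.map φ).comap φ = S := by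
      rw [comap_map_eq, hker, sup_eq_left, span_singleton_le_iff_mem]
      exact hxS
    refine ⟨⟨S.map φ, ?_⟩, e.symm⟩
    have := hcf (S.map φ)
    rw [e] at this
    omega
  have hcl : ∀ A B : Submodule F (Fin (n - 1) → F), A.comap φ ≤ B.comap φ ↔ A ≤ B :=
    fun A B => comap_le_comap_iff_of_surjective hs
  have key : ∀ (b : Prop) (g' : Gr F (n - 1) (k - 1) → Bool), (∀ T, g T = true ↔ (b ↔ g' T = true)) →
      GrTrivPat g' → ∃ b P N, GSLoc F k (fun S => ∃ h : finrank F S = k, f ⟨S, h⟩ = true) x b P N := by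
    intro b g' hg' hpat
    have fin : ∀ (b : Prop) (P N : Submodule F (Fin n → F)), x ∈ P → (P = ⊤ ∨ finrank F P = 2) →
        (N = ⊥ ∨ (finrank F N + 1 = finrank F (Fin n → F) ∧ x ∈ N)) → ¬ P ≤ N →
        (∀ T : Gr F (n - 1) (k - 1), g T = true ↔
          (b ↔ (P ≤ T.val.comap φ ∨ T.val.comap φ ≤ N))) →
        ∃ b P N, GSLoc F k (fun S => ∃ h : finrank F S = k, f ⟨S, h⟩ = true) x b P N := by
      intro b P N h1 h2 h3 h4 h5
      refine ⟨b, P, N, h1, h2, h3, h4, fun S hS hxS => ?_⟩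
      obtain ⟨T, rfl⟩ := hlift S hS hxS
      rw [← h5 T]
      simp only [g, hS, exists_true_left]
    have nb : ∀ T : Gr F (n - 1) (k - 1), ¬ T.val.comap φ ≤ ⊥ := fun T =>
      gs_not_le (by rw [finrank_bot, hc]; omega)
    have nt : ∀ T : Gr F (n - 1) (k - 1), ¬ ⊤ ≤ T.val.comap φ := fun T =>
      gs_not_le (by rw [ht, hc]; omega)
    rcases hpat with h | ⟨p, hp, h⟩ | ⟨N, hN, h⟩ | ⟨p, N, hp, hN, hpN, h⟩
    · refine fin (¬ b) ⊤ ⊥ trivial (Or.inl rfl) (Or.inl rfl)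
        (gs_not_le (by rw [finrank_bot, ht]; omega)) (fun T => ?_)
      rw [hg', h]
      simp [nb, nt, -top_le_iff, -le_bot_iff]
    · refine fin b (p.comap φ) ⊥ (hxc p) (Or.inr (by rw [hcf, hp])) (Or.inl rfl)
        (gs_not_le (by rw [finrank_bot, hcf]; omega)) (fun T => ?_)
      rw [hg', h, hcl]
      simp only [nb, or_false]
    · refine fin b ⊤ (N.comap φ) trivial (Or.inl rfl)
        (Or.inr ⟨by rw [hcf, hN, hV]; omega, hxc N⟩)
        (gs_not_le (by rw [hcf, hN, ht]; omega)) (fun T => ?_)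
      rw [hg', h, hcl]
      simp only [nt, false_or]
    · refine fin b (p.comap φ) (N.comap φ) (hxc p) (Or.inr (by rw [hcf, hp]))
        (Or.inr ⟨by rw [hcf, hN, hV]; omega, hxc N⟩) (by rwa [hcl]) (fun T => ?_)
      rw [hg', h, hcl, hcl]
  rcases hg with hg | hg
  · exact key True g (fun T => by simp) hg
  · exact key False _ (fun T => by simp) hg

theorem gs_pat {F : Type*} [Field F] [Fintype F] {n k : ℕ} {Φ : Submodule F (Fin n → F) → Prop}
    (f : Gr F n k → Bool) (hf : ∀ S : Gr F n k, f S = true ↔ Φ S.val) (h : GSPat F k Φ) :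
    GrTrivPat f := by
  have hV : finrank F (Fin n → F) = n := by simp
  rcases h with ⟨p, hp, h⟩ | ⟨N, hN, h⟩ | ⟨p, N, hp, hN, hpN, h⟩
  · exact Or.inr (Or.inl ⟨p, hp, fun S => (hf S).trans (h S.val S.2)⟩)
  · exact Or.inr (Or.inr (Or.inl ⟨N, by omega, fun S => (hf S).trans (h S.val S.2)⟩))
  · exact Or.inr (Or.inr (Or.inr ⟨p, N, hp, by omega, hpN, fun S => (hf S).trans (h S.val S.2)⟩))

end GSfinal

/-- Inductive step for the Grassmann scheme: for `k > 2` and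
`n − k > 2`, if every Boolean degree 1 function on `J_q(n−1, k−1)` is trivial,
then every Boolean degree 1 function on `J_q(n, k)` is trivial. -/
theorem grassmann_inductive_step (F : Type*) [Field F] [Fintype F] (n k : ℕ)
    (hk : 2 < k) (hnk : 2 < n - k)
    (H : ∀ g : Gr F (n - 1) (k - 1) → Bool, GrDegOne g → GrTrivial g) :
    ∀ f : Gr F n k → Bool, GrDegOne f → GrTrivial f := by
  intro f hf
  have hV : finrank F (Fin n → F) = n := by simp
  have hfΦ : ∀ S : Gr F n k, f S = true ↔ ∃ h : finrank F S.val = k, f ⟨S.val, h⟩ = true :=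
    fun S => ⟨fun h => ⟨S.2, h⟩, fun ⟨_, h⟩ => h⟩
  rcases gs_main (F := F) (V := Fin n → F) hk (by omega)
    (fun x hx => gs_local hk hnk H f hf x hx) with h | h | h | h
  · exact Or.inl (gs_pat f hfΦ h)
  · exact Or.inr (gs_pat _ (fun S => by rw [← hfΦ S]; simp) h)
  · exact Or.inl (Or.inl fun S => (hfΦ S).2 (h S.val S.2))
  · refine Or.inr (Or.inl fun S => ?_)
    have := h S.val S.2
    rw [← hfΦ S] at this
    simpa using this
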